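/- arXiv:1610.02727 — 2 statements merged into one kernel-verified Lean document; each statement's English description precedes it below -/
import Mathlib

section
/- (Krieger's Marker Lemma, aperiodic case.) Let (X,T) be an aperiodic zero-dimensional topological dynamical system (X a nonempty compact metric space with a basis of clopen sets, T : X → X a homeomorphism with no periodic points). Then for every n ≥ 1 there exists a clopen set F ⊆ X such that (1) the sets F, T^{-1}F, …, T^{-(n-1)}F are pairwise disjoint, and (2) F ∪ T^{-1}F ∪ … ∪ T^{-(2n-2)}F = X. -/
open TopologicalSpace

/-- A topology has a basis of clopen sets (zero-dimensionality). -/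
def ZeroDim (X : Type*) [TopologicalSpace X] : Prop :=
  ∃ B : Set (Set X), (∀ s ∈ B, IsClopen s) ∧ IsTopologicalBasis B

/-- Aperiodicity: no periodic points. -/
def Aperiodic' {X : Type*} (T : X ≃ X) : Prop :=
  ∀ (x : X) (n : ℕ), 1 ≤ n → (T ^ n) x ≠ x

open Filter Topology in
/-- Points of a Hausdorff space moved by a continuous map have small neighbourhoods disjoint from
their image. -/
theorem eventually_smallSets_map_notMem {X : Type*} [TopologicalSpace X] [T2Space X] {f : X → X}
    {x : X} (hf : ContinuousAt f x) (hx : f x ≠ x) :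
    ∀ᶠ U in (𝓝 x).smallSets, ∀ y ∈ U, f y ∉ U := by
  obtain ⟨A, B, hA, hB, hxA, hxB, hAB⟩ := t2_separation hx
  have hV : B ∩ f ⁻¹' A ∈ 𝓝 x :=
    inter_mem (hB.mem_nhds hxB) (hf.preimage_mem_nhds (hA.mem_nhds hxA))
  rw [eventually_smallSets]
  refine ⟨_, hV, fun U hU y hy hfy => ?_⟩
  exact Set.disjoint_left.1 hAB (hU hy).2 (hU hfy).1

theorem Homeomorph.continuous_toEquiv_zpow {X : Type*} [TopologicalSpace X] (T : X ≃ₜ X) (k : ℤ) :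
    Continuous ⇑(T.toEquiv ^ k : Equiv.Perm X) := by
  let φ : (X ≃ₜ X) →* Equiv.Perm X :=
    { toFun := Homeomorph.toEquiv, map_one' := rfl, map_mul' := fun _ _ => rfl }
  have h : φ (T ^ k) = (T.toEquiv ^ k : Equiv.Perm X) := map_zpow φ T k
  rw [← h]
  exact (T ^ k).continuous

theorem Aperiodic'.zpow_ne {X : Type*} {T : Equiv.Perm X} (h : Aperiodic' T) (x : X) {k : ℤ}
    (hk : k ≠ 0) : (T ^ k) x ≠ x := by
  intro hx
  obtain ⟨m, rfl | rfl⟩ := k.eq_nat_or_neg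
  · exact h x m (by omega) (by simpa using hx)
  · refine h x m (by omega) ?_
    rw [zpow_neg, Equiv.Perm.inv_eq_iff_eq, zpow_natCast] at hx
    exact hx.symm

/-- Distinct points of `F` on a common orbit are at time distance at least `n`. -/
def OrbitSeparated {X : Type*} (T : Equiv.Perm X) (n : ℕ) (F : Set X) : Prop :=
  ∀ k ∈ (Finset.Ioo (-n : ℤ) n).erase 0, ∀ x ∈ F, (T ^ k) x ∉ F

/-- The points whose orbit meets `F` at a time of absolute value less than `n`. -/
def orbitNhd {X : Type*} (T : Equiv.Perm X) (n : ℕ) (F : Set X) : Set X :=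
  ⋃ k ∈ Finset.Ioo (-n : ℤ) n, ⇑(T ^ k) ⁻¹' F

theorem mem_orbitNhd {X : Type*} {T : Equiv.Perm X} {n : ℕ} {F : Set X} {x : X} :
    x ∈ orbitNhd T n F ↔ ∃ k : ℤ, (-n < k ∧ k < n) ∧ (T ^ k) x ∈ F := by
  simp [orbitNhd]

theorem orbitNhd_mono {X : Type*} {T : Equiv.Perm X} {n : ℕ} {F G : Set X} (h : F ⊆ G) :
    orbitNhd T n F ⊆ orbitNhd T n G :=
  Set.iUnion₂_mono fun _ _ => Set.preimage_mono h

theorem subset_orbitNhd {X : Type*} {T : Equiv.Perm X} {n : ℕ} (hn : 1 ≤ n) (F : Set X) :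
    F ⊆ orbitNhd T n F :=
  fun x hx => mem_orbitNhd.2 ⟨0, by omega, by simpa using hx⟩

theorem OrbitSeparated.union_diff {X : Type*} {T : Equiv.Perm X} {n : ℕ} {F U : Set X}
    (hF : OrbitSeparated T n F) (hU : OrbitSeparated T n U) :
    OrbitSeparated T n (F ∪ (U \ orbitNhd T n F)) := by
  intro k hk x hx hkx
  have hk' := hk
  simp only [Finset.mem_erase, Finset.mem_Ioo] at hk'
  rcases hx with hx | hx <;> rcases hkx with hkx | hkx
  · exact hF k hk x hx hkx
  · exact hkx.2 (mem_orbitNhd.2 ⟨-k, by omega, by simpa using hx⟩)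
  · exact hx.2 (mem_orbitNhd.2 ⟨k, by omega, hkx⟩)
  · exact hU k hk x hx.1 hkx.1

theorem exists_isClopen_orbitSeparated_nhd {X : Type*} [TopologicalSpace X] [T2Space X]
    (T : X ≃ₜ X) (hzero : ZeroDim X) (haper : Aperiodic' T.toEquiv) (n : ℕ) (x : X) :
    ∃ U : Set X, x ∈ U ∧ IsClopen U ∧ OrbitSeparated T.toEquiv n U := by
  obtain ⟨B, hB, hbasis⟩ := hzero
  have h := (Filter.eventually_all_finset ((Finset.Ioo (-n : ℤ) n).erase 0)).2 fun k hk =>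
    eventually_smallSets_map_notMem (T.continuous_toEquiv_zpow k).continuousAt
      (haper.zpow_ne x (Finset.ne_of_mem_erase hk))
  obtain ⟨V, hV, hsep⟩ := Filter.eventually_smallSets.1 h
  obtain ⟨U, hU, hxU, hUV⟩ := hbasis.mem_nhds_iff.1 hV
  exact ⟨U, hxU, hB U hU, hsep U hUV⟩

theorem IsClopen.orbitNhd {X : Type*} [TopologicalSpace X] {T : X ≃ₜ X} {F : Set X}
    (hF : IsClopen F) (n : ℕ) : IsClopen (orbitNhd T.toEquiv n F) :=
  isClopen_biUnion_finset fun k _ => hF.preimage (T.continuous_toEquiv_zpow k)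

theorem exists_isClopen_orbitSeparated_orbitNhd_eq_univ {X : Type*} [TopologicalSpace X]
    [T2Space X] [CompactSpace X] (T : X ≃ₜ X) (hzero : ZeroDim X)
    (haper : Aperiodic' T.toEquiv) {n : ℕ} (hn : 1 ≤ n) :
    ∃ F : Set X, IsClopen F ∧ OrbitSeparated T.toEquiv n F ∧
      orbitNhd T.toEquiv n F = Set.univ := by
  classical
  choose U hxU hUc hUs using exists_isClopen_orbitSeparated_nhd T hzero haper n
  obtain ⟨t, ht⟩ := CompactSpace.elim_nhds_subcover U fun x => (hUc x).isOpen.mem_nhds (hxU x)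
  suffices h : ∀ s : Finset X, ∃ F : Set X, IsClopen F ∧ OrbitSeparated T.toEquiv n F ∧
      ∀ x ∈ s, U x ⊆ orbitNhd T.toEquiv n F by
    obtain ⟨F, hFc, hFs, hF⟩ := h t
    refine ⟨F, hFc, hFs, Set.univ_subset_iff.1 ?_⟩
    rw [← Set.top_eq_univ, ← ht]
    exact Set.iUnion₂_subset hF
  intro s
  induction s using Finset.induction_on with
  | empty => exact ⟨∅, isClopen_empty, fun _ _ _ h => h.elim, by simp⟩
  | insert a s _ ih =>
    obtain ⟨F, hFc, hFs, hF⟩ := ih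
    refine ⟨F ∪ (U a \ orbitNhd T.toEquiv n F), hFc.union ((hUc a).diff (hFc.orbitNhd n)),
      hFs.union_diff (hUs a), fun x hx => ?_⟩
    rcases Finset.mem_insert.1 hx with rfl | hx
    · intro y hy
      by_cases hyF : y ∈ orbitNhd T.toEquiv n F
      · exact orbitNhd_mono Set.subset_union_left hyF
      · exact subset_orbitNhd hn _ (Or.inr ⟨hy, hyF⟩)
    · exact (hF x hx).trans (orbitNhd_mono Set.subset_union_left)

theorem stmt_5 {X : Type*} [MetricSpace X] [CompactSpace X] [Nonempty X] (T : X ≃ₜ X)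
    (hzero : ZeroDim X) (haper : Aperiodic' T.toEquiv) (n : ℕ) (hn : 1 ≤ n) :
    ∃ F : Set X, IsClopen F ∧
      (∀ i j : ℕ, i < n → j < n → i ≠ j →
        Disjoint (⇑(T.toEquiv ^ i) ⁻¹' F) (⇑(T.toEquiv ^ j) ⁻¹' F)) ∧
      (⋃ i ∈ Finset.range (2 * n - 1), ⇑(T.toEquiv ^ i) ⁻¹' F) = Set.univ := by
  obtain ⟨F, hFc, hFs, hF⟩ :=
    exists_isClopen_orbitSeparated_orbitNhd_eq_univ T hzero haper hn
  refine ⟨F, hFc, fun i j hi hj hij => ?_, Set.eq_univ_of_forall fun x => ?_⟩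
  · refine Set.disjoint_left.2 fun x hxi hxj => ?_
    refine hFs (j - i) ?_ _ hxi ?_
    · simp only [Finset.mem_erase, Finset.mem_Ioo]
      omega
    · rw [← zpow_natCast, ← Equiv.Perm.mul_apply, ← zpow_add, sub_add_cancel, zpow_natCast]
      exact hxj
  · have hx : (T.toEquiv ^ ((n : ℤ) - 1) : Equiv.Perm X) x ∈ orbitNhd T.toEquiv n F :=
      hF ▸ Set.mem_univ _
    obtain ⟨k, hk, hkF⟩ := mem_orbitNhd.1 hx
    rw [← Equiv.Perm.mul_apply, ← zpow_add] at hkF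
    obtain ⟨m, hm⟩ := Int.eq_ofNat_of_zero_le (a := k + (n - 1)) (by omega)
    rw [hm, zpow_natCast] at hkF
    exact Set.mem_biUnion (Finset.mem_coe.2 (Finset.mem_range.2 (by omega))) hkF
end

section
/- (Vertical data compression.) Let X ⊆ Λ^ℤ be a nonempty aperiodic subshift over a finite alphabet Λ (closed, shift-invariant, no periodic points) with topological entropy h = lim_{n→∞} (1/n) log₂ #B_n(X). Let ℓ be the smallest integer strictly larger than 2^h. Then X is topologically conjugate (via a homeomorphism commuting with the shifts) to a subshift Y ⊆ A^ℤ over an alphabet A of cardinality ℓ. -/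
open Filter

/-- The shift map on bi-infinite sequences over an alphabet `Λ`. -/
def shiftMap {Λ : Type*} (x : ℤ → Λ) : ℤ → Λ := fun n => x (n + 1)

/-- The `n`-th iterate (`n ∈ ℤ`) of the shift map. -/
def shiftZ {Λ : Type*} (n : ℤ) (x : ℤ → Λ) : ℤ → Λ := fun m => x (m + n)

/-- The words of length `n` occurring in elements of `X`. -/
def wordsOf {Λ : Type*} (X : Set (ℤ → Λ)) (n : ℕ) : Set (Fin n → Λ) :=
  {w | ∃ x ∈ X, ∃ m : ℤ, ∀ i : Fin n, w i = x (m + (i : ℤ))}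

open scoped Topology

/-- **Marker lemma** for free continuous `ℤ`-actions on compact zero-dimensional spaces. -/
theorem exists_isClopen_marker {X : Type*} [TopologicalSpace X] [CompactSpace X] [T2Space X]
    [TotallyDisconnectedSpace X] [AddAction ℤ X] [ContinuousConstVAdd ℤ X]
    (hfree : ∀ (x : X) (n : ℤ), 0 < n → n +ᵥ x ≠ x) {N : ℕ} (hN : 0 < N) :
    ∃ F : Set X, IsClopen F ∧ (∀ x ∈ F, ∀ i : ℤ, 0 < i → i < N → i +ᵥ x ∉ F) ∧
      ∀ x, ∃ i ∈ Finset.Ioo (-N : ℤ) N, i +ᵥ x ∈ F := by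
  have hnhds : ∀ x : X, ∃ U : Set X, IsClopen U ∧ x ∈ U ∧
      ∀ y ∈ U, ∀ i : ℤ, 0 < i → i < N → i +ᵥ y ∉ U := by
    intro x
    have hsep : ∀ i : ℤ, ∃ V ∈ 𝓝 x, 0 < i → ∀ y ∈ V, i +ᵥ y ∉ V := by
      intro i
      by_cases hi : 0 < i
      · obtain ⟨U, W, hU, hW, hxU, hxW, hUW⟩ := t2_separation (hfree x i hi)
        refine ⟨W ∩ (i +ᵥ ·) ⁻¹' U, inter_mem (hW.mem_nhds hxW)
          ((hU.preimage (continuous_const_vadd i)).mem_nhds hxU), fun _ y hy hy' => ?_⟩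
        exact Set.disjoint_left.1 hUW hy.2 hy'.1
      · exact ⟨Set.univ, univ_mem, fun h => absurd h hi⟩
    choose V hV hV' using hsep
    have hmem : (⋂ i ∈ Finset.Ioo (0 : ℤ) N, V i) ∈ 𝓝 x :=
      (biInter_finset_mem _).2 fun i _ => hV i
    obtain ⟨O, hOV, hO, hxO⟩ := mem_nhds_iff.1 hmem
    obtain ⟨U, hU, hxU, hUO⟩ := compact_exists_isClopen_in_isOpen hO hxO
    refine ⟨U, hU, hxU, fun y hy i hi hiN hy' => ?_⟩
    have hsub : ∀ z ∈ U, z ∈ V i := fun z hz =>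
      Set.mem_iInter₂.1 (hOV (hUO hz)) i (Finset.mem_Ioo.2 ⟨hi, hiN⟩)
    exact hV' i hi y (hsub y hy) (hsub _ hy')
  choose U hU hxU hUdisj using hnhds
  obtain ⟨t, ht⟩ := isCompact_univ.elim_finite_subcover U (fun x => (hU x).isOpen)
    fun x _ => Set.mem_iUnion.2 ⟨x, hxU x⟩
  have hind : ∀ t : Finset X, ∃ F : Set X, IsClopen F ∧
      (∀ x ∈ F, ∀ i : ℤ, 0 < i → i < N → i +ᵥ x ∉ F) ∧
      ∀ a ∈ t, ∀ x ∈ U a, ∃ i ∈ Finset.Ioo (-N : ℤ) N, i +ᵥ x ∈ F := by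
    classical
    intro t
    induction t using Finset.induction_on with
    | empty => exact ⟨∅, isClopen_empty, by simp, by simp⟩
    | insert a t _ ih =>
      obtain ⟨F, hF, hdisj, hcov⟩ := ih
      let E : Set X := ⋃ i ∈ Finset.Ioo (-N : ℤ) N, (i +ᵥ ·) ⁻¹' F
      have hE : IsClopen E :=
        isClopen_biUnion_finset fun i _ => hF.preimage (continuous_const_vadd i)
      have hmemE : ∀ z, z ∈ E ↔ ∃ i ∈ Finset.Ioo (-N : ℤ) N, i +ᵥ z ∈ F := by simp [E]
      refine ⟨F ∪ (U a \ E), hF.union ((hU a).diff hE), ?_, ?_⟩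
      · rintro x (hx | hx) i hi hiN (hy | hy)
        · exact hdisj x hx i hi hiN hy
        · refine hy.2 ((hmemE _).2 ⟨-i, Finset.mem_Ioo.2 ⟨by omega, by omega⟩, ?_⟩)
          rwa [neg_vadd_vadd]
        · exact hx.2 ((hmemE _).2 ⟨i, Finset.mem_Ioo.2 ⟨by omega, by omega⟩, hy⟩)
        · exact hUdisj a x hx.1 i hi hiN hy.1
      · intro b hb x hx
        rcases Finset.mem_insert.1 hb with rfl | hb
        · by_cases hxE : x ∈ E
          · obtain ⟨i, hi, hiF⟩ := (hmemE x).1 hxE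
            exact ⟨i, hi, Or.inl hiF⟩
          · exact ⟨0, Finset.mem_Ioo.2 ⟨by omega, by omega⟩, by
              rw [zero_vadd]; exact Or.inr ⟨hx, hxE⟩⟩
        · obtain ⟨i, hi, hiF⟩ := hcov b hb x hx
          exact ⟨i, hi, Or.inl hiF⟩
  obtain ⟨F, hF, hdisj, hcov⟩ := hind t
  refine ⟨F, hF, hdisj, fun x => ?_⟩
  obtain ⟨a, ha, hxa⟩ := Set.mem_iUnion₂.1 (ht (Set.mem_univ x))
  exact hcov a ha x hxa

/-- The positions of a block of length `n` that carry data, in a code whose blocks start with a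
marker of length `2 * k` and have a separator at each multiple of `k`. -/
def freePositions (k n : ℕ) : Finset ℕ :=
  (Finset.range n).filter fun j => 2 * k ≤ j ∧ ¬ k ∣ j

theorem le_card_freePositions {k : ℕ} (n : ℕ) :
    n ≤ (freePositions k n).card + 2 * k + n / k + 1 := by
  have hsub : Finset.range n ⊆ (freePositions k n ∪ Finset.range (2 * k)) ∪
      ({0} ∪ (Finset.Ioc 0 n).filter (k ∣ ·)) := by
    intro j hj
    simp only [freePositions, Finset.mem_union, Finset.mem_filter, Finset.mem_range,
      Finset.mem_singleton, Finset.mem_Ioc] at hj ⊢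
    by_cases h1 : k ∣ j <;> simp only [h1, not_true, not_false_eq_true, and_true, and_false] <;>
      omega
  have h1 := Finset.card_le_card hsub
  have h2 := Finset.card_union_le (freePositions k n ∪ Finset.range (2 * k))
    ({0} ∪ (Finset.Ioc 0 n).filter (k ∣ ·))
  have h3 := Finset.card_union_le (freePositions k n) (Finset.range (2 * k))
  have h4 := Finset.card_union_le {0} ((Finset.Ioc 0 n).filter (k ∣ ·))
  rw [Nat.Ioc_filter_dvd_card_eq_div] at h4
  simp only [Finset.card_range, Finset.card_singleton] at h1 h2 h3 h4
  omega

/-- If the growth rate of `a n` is less than `log₂ ℓ`, then `a n` is bounded by the number of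
`ℓ`-ary labellings of the free positions of a block of length `n`. -/
theorem exists_le_pow_card_freePositions {a : ℕ → ℕ} {h : ℝ} {ℓ : ℕ}
    (ha : Tendsto (fun n : ℕ => Real.logb 2 (a n) / (n : ℝ)) atTop (𝓝 h))
    (hℓ : (2 : ℝ) ^ h < ℓ) (hpos : ∀ n, 0 < a n) :
    ∃ k, 0 < k ∧ ∀ᶠ n in atTop, a n ≤ ℓ ^ (freePositions k n).card := by
  have hℓ0 : (0 : ℝ) < ℓ := lt_trans (by positivity) hℓ
  set L := Real.logb 2 ℓ with hL
  have hhL : h < L := (Real.lt_logb_iff_rpow_lt one_lt_two hℓ0).2 hℓ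
  have hh0 : 0 ≤ h := ge_of_tendsto' ha fun n =>
    div_nonneg (Real.logb_nonneg one_lt_two (by exact_mod_cast hpos n)) n.cast_nonneg
  have hL0 : 0 < L := hh0.trans_lt hhL
  obtain ⟨c, hhc, hcL⟩ := exists_between hhL
  obtain ⟨k, hk⟩ := exists_nat_gt (2 * L / (L - c))
  have hLc : 0 < L - c := sub_pos.2 hcL
  have hk0 : (0 : ℝ) < k := lt_trans (by positivity) hk
  rw [div_lt_iff₀ hLc] at hk
  obtain ⟨M, hM⟩ := exists_nat_gt (2 * L * (2 * k + 1) / (L - c))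
  rw [div_lt_iff₀ hLc] at hM
  refine ⟨k, by exact_mod_cast hk0, ?_⟩
  filter_upwards [ha.eventually_lt_const hhc, eventually_ge_atTop M, eventually_gt_atTop 0]
    with n hn hMn hn0
  have hn0' : (0 : ℝ) < n := by exact_mod_cast hn0
  have ha0 : (0 : ℝ) < a n := by exact_mod_cast hpos n
  rw [div_lt_iff₀ hn0'] at hn
  have hcard : (n : ℝ) ≤ (freePositions k n).card + 2 * k + n / k + 1 := by
    have h1 : (n : ℝ) ≤ (freePositions k n).card + 2 * k + (n / k : ℕ) + 1 := by
      exact_mod_cast le_card_freePositions n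
    linarith [Nat.cast_div_le (α := ℝ) (m := n) (n := k)]
  have hnk : 2 * L * (n / k) ≤ (L - c) * n := by
    rw [← mul_div_assoc, div_le_iff₀ hk0]
    nlinarith
  have hMn' : (M : ℝ) ≤ n := by exact_mod_cast hMn
  have hlog : Real.logb 2 (a n) ≤ (freePositions k n).card * L := by
    nlinarith [mul_le_mul_of_nonneg_left hcard hL0.le, mul_le_mul_of_nonneg_left hMn' hLc.le]
  have hpow : (a n : ℝ) ≤ (ℓ : ℝ) ^ (freePositions k n).card := by
    rw [← Real.logb_le_logb one_lt_two ha0 (by positivity), Real.logb_pow]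
    exact hlog
  exact_mod_cast hpow

theorem wordsOf_nonempty {Λ : Type*} {X : Set (ℤ → Λ)} (hX : X.Nonempty) (n : ℕ) :
    (wordsOf X n).Nonempty := by
  obtain ⟨x, hx⟩ := hX
  exact ⟨fun i => x (0 + (i : ℤ)), x, hx, 0, fun _ => rfl⟩

/-- The words of a finite-entropy subshift can be encoded in the free positions of blocks of the
same length. -/
theorem exists_word_encoding {Λ : Type} [Fintype Λ] {X : Set (ℤ → Λ)} (hX : X.Nonempty) {h : ℝ}
    (hent : Tendsto (fun n : ℕ => Real.logb 2 (Nat.card (wordsOf X n)) / (n : ℝ)) atTop (𝓝 h))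
    {ℓ : ℕ} (hℓ : (2 : ℝ) ^ h < ℓ) :
    ∃ k N : ℕ, 0 < k ∧ 2 * k ≤ N ∧ ∃ e : (n : ℕ) → (Fin n → Λ) → ℕ → Fin ℓ,
      ∀ n, N ≤ n → ∀ w ∈ wordsOf X n, ∀ w' ∈ wordsOf X n,
        (∀ j ∈ freePositions k n, e n w j = e n w' j) → w = w' := by
  classical
  have hℓ0 : 0 < ℓ := by exact_mod_cast (Real.rpow_pos_of_pos two_pos h).trans hℓ
  obtain ⟨k, hk, hev⟩ := exists_le_pow_card_freePositions hent hℓ fun n => by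
    have := (wordsOf_nonempty hX n).to_subtype
    exact Nat.card_pos
  obtain ⟨N, hN⟩ := eventually_atTop.1 hev
  have hemb : ∀ n, ∃ f : (Fin n → Λ) → ℕ → Fin ℓ, N ≤ n →
      ∀ w ∈ wordsOf X n, ∀ w' ∈ wordsOf X n,
        (∀ j ∈ freePositions k n, f w j = f w' j) → w = w' := by
    intro n
    by_cases hn : N ≤ n
    · have hcard : Fintype.card (wordsOf X n) ≤ Fintype.card (freePositions k n → Fin ℓ) := by
        simpa [Nat.card_eq_fintype_card] using hN n hn
      obtain ⟨g⟩ := Function.Embedding.nonempty_of_card_le hcard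
      refine ⟨fun w j => if hw : w ∈ wordsOf X n then
        if hj : j ∈ freePositions k n then g ⟨w, hw⟩ ⟨j, hj⟩ else ⟨0, hℓ0⟩ else ⟨0, hℓ0⟩,
        fun _ w hw w' hw' heq => ?_⟩
      have hg : g ⟨w, hw⟩ = g ⟨w', hw'⟩ := by
        ext ⟨j, hj⟩
        simpa [hw, hw', hj] using congrArg Fin.val (heq j hj)
      exact congrArg Subtype.val (g.injective hg)
    · exact ⟨fun _ _ => ⟨0, hℓ0⟩, fun h => absurd h hn⟩
  choose e he using hemb
  exact ⟨k, max N (2 * k), hk, le_max_right _ _, e, fun n hn =>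
    he n ((le_max_left _ _).trans hn)⟩

/-- A block with data `d`: the marker `1 0 ⋯ 0` of length `2 * k`, then `d` with a separator `1` at
each multiple of `k`. -/
def blockCode {A : Type*} (a b : A) (k : ℕ) (d : ℕ → A) (j : ℕ) : A :=
  if j = 0 then b else if j < 2 * k then a else if k ∣ j then b else d j

/-- `p` and `p + n` are consecutive visits of the orbit of `x` to `F`. -/
structure IsReturnBlock {X : Type*} [AddAction ℤ X] (F : Set X) (x : X) (p : ℤ) (n : ℕ) :
    Prop where
  left_mem : p +ᵥ x ∈ F
  right_mem : (p + n) +ᵥ x ∈ F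
  pos : 0 < n
  notMem : ∀ j : ℕ, 0 < j → j < n → (p + j) +ᵥ x ∉ F

section Return

variable {X : Type*} [AddAction ℤ X] {F : Set X}

theorem IsReturnBlock.congr {x x' : X} {p : ℤ} {n : ℕ} (hb : IsReturnBlock F x p n)
    (hxx' : ∀ i : ℤ, i +ᵥ x ∈ F ↔ i +ᵥ x' ∈ F) : IsReturnBlock F x' p n :=
  ⟨(hxx' _).1 hb.left_mem, (hxx' _).1 hb.right_mem, hb.pos,
    fun j hj hjn h => hb.notMem j hj hjn ((hxx' _).2 h)⟩

theorem IsReturnBlock.le_length {N n : ℕ} {x : X} {p : ℤ} (hb : IsReturnBlock F x p n)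
    (hdisj : ∀ x ∈ F, ∀ i : ℤ, 0 < i → i < N → i +ᵥ x ∉ F) : N ≤ n := by
  by_contra! hlt
  refine hdisj _ hb.left_mem n (by exact_mod_cast hb.pos) (by exact_mod_cast hlt) ?_
  rw [vadd_vadd, add_comm]
  exact hb.right_mem

/-- Every position lies in the return block between the last visit before it and the first visit
after it. -/
theorem isReturnBlock_of_find [DecidablePred (· ∈ F)] {x : X} (i : ℤ)
    (hr : ∃ r : ℕ, (-(r : ℤ)) +ᵥ i +ᵥ x ∈ F) (hs : ∃ s : ℕ, ((s : ℤ) + 1) +ᵥ i +ᵥ x ∈ F) :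
    IsReturnBlock F x (i - Nat.find hr) (Nat.find hr + Nat.find hs + 1) := by
  refine ⟨?_, ?_, by omega, fun j hj hjn hmem => ?_⟩
  · have h := Nat.find_spec hr
    rw [vadd_vadd] at h
    convert h using 2
    ring
  · have h := Nat.find_spec hs
    rw [vadd_vadd] at h
    convert h using 2
    push_cast
    ring
  · rcases le_or_gt j (Nat.find hr) with hle | hgt
    · refine Nat.find_min hr (m := Nat.find hr - j) (by omega) ?_
      rw [vadd_vadd]
      convert hmem using 2
      omega
    · refine Nat.find_min hs (m := j - Nat.find hr - 1) (by omega) ?_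
      rw [vadd_vadd]
      convert hmem using 2
      omega

theorem IsReturnBlock.find_eq [DecidablePred (· ∈ F)] {x : X} {p : ℤ} {n j : ℕ}
    (hb : IsReturnBlock F x p n) (hj : j < n)
    (hr : ∃ r : ℕ, (-(r : ℤ)) +ᵥ (p + (j : ℤ)) +ᵥ x ∈ F)
    (hs : ∃ s : ℕ, ((s : ℤ) + 1) +ᵥ (p + (j : ℤ)) +ᵥ x ∈ F) :
    Nat.find hr = j ∧ Nat.find hs = n - 1 - j := by
  constructor
  · rw [Nat.find_eq_iff]
    refine ⟨?_, fun m hm hmem => hb.notMem (j - m) (by omega) (by omega) ?_⟩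
    · rw [vadd_vadd]
      convert hb.left_mem using 2
      ring
    · rw [vadd_vadd] at hmem
      convert hmem using 2
      omega
  · rw [Nat.find_eq_iff]
    refine ⟨?_, fun m hm hmem => hb.notMem (j + m + 1) (by omega) (by omega) ?_⟩
    · rw [vadd_vadd]
      convert hb.right_mem using 2
      omega
    · rw [vadd_vadd] at hmem
      convert hmem using 2
      omega

end Return

/-- A sequence composed of blocks `blockCode` along the visits of `x` to `F` determines these
visits. -/
theorem vadd_mem_iff_of_blockCode {X A : Type*} [AddAction ℤ X] {F : Set X} {x : X} {a b : A}
    (hab : a ≠ b) {k N : ℕ} (hk : 0 < k) (hkN : 2 * k ≤ N)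
    (hdisj : ∀ x ∈ F, ∀ i : ℤ, 0 < i → i < N → i +ᵥ x ∉ F)
    (hblock : ∀ i : ℤ, ∃ (p : ℤ) (n j : ℕ), IsReturnBlock F x p n ∧ j < n ∧ i = p + j)
    {y : ℤ → A}
    (hy : ∀ p n, IsReturnBlock F x p n →
      ∃ d : ℕ → A, ∀ j : ℕ, j < n → y (p + j) = blockCode a b k d j) (i : ℤ) :
    i +ᵥ x ∈ F ↔ y i = b ∧ ∀ t : ℕ, 0 < t → t ≤ k → y (i + t) = a := by
  have hstart : ∀ i : ℤ, i +ᵥ x ∈ F → ∃ n, IsReturnBlock F x i n := by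
    intro i hi
    obtain ⟨p, n, j, hb, hj, rfl⟩ := hblock i
    rcases Nat.eq_zero_or_pos j with rfl | hj0
    · exact ⟨n, by simpa using hb⟩
    · exact absurd hi (hb.notMem j hj0 hj)
  have hstart_eq : ∀ i : ℤ, i +ᵥ x ∈ F → y i = b := by
    intro i hi
    obtain ⟨n, hb⟩ := hstart i hi
    obtain ⟨d, hd⟩ := hy _ _ hb
    simpa [blockCode] using hd 0 hb.pos
  constructor
  · intro hi
    refine ⟨hstart_eq i hi, fun t ht htk => ?_⟩
    obtain ⟨n, hb⟩ := hstart i hi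
    obtain ⟨d, hd⟩ := hy _ _ hb
    have hn := hb.le_length hdisj
    rw [hd t (by omega), blockCode, if_neg (by omega), if_pos (by omega)]
  · rintro ⟨hib, hia⟩
    obtain ⟨p, n, j, hb, hj, rfl⟩ := hblock i
    obtain ⟨d, hd⟩ := hy _ _ hb
    rcases Nat.eq_zero_or_pos j with rfl | hj0
    · simpa using hb.left_mem
    · exfalso
      by_cases hj2 : j < 2 * k
      · rw [hd j hj, blockCode, if_neg (by omega), if_pos hj2] at hib
        exact hab hib
      · have hmod := Nat.mod_lt j hk
        have hdvd : k ∣ j + (k - j % k) := by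
          have := Nat.div_add_mod j k
          exact ⟨j / k + 1, by rw [mul_add]; omega⟩
        rcases lt_or_ge (j + (k - j % k)) n with hlt | hge
        · have h1 := hia (k - j % k) (by omega) (by omega)
          rw [add_assoc, ← Nat.cast_add, hd _ hlt, blockCode, if_neg (by omega),
            if_neg (by omega), if_pos hdvd] at h1
          exact hab h1.symm
        · have h1 := hia (n - j) (by omega) (by omega)
          rw [add_assoc, ← Nat.cast_add, Nat.add_sub_cancel' hj.le,
            hstart_eq _ hb.right_mem] at h1
          exact hab h1.symm

/-- The shift action on a shift-invariant set of sequences. -/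
abbrev subshiftAddAction {Λ : Type*} (X : Set (ℤ → Λ))
    (hXinv : ∀ x, x ∈ X ↔ shiftMap x ∈ X) : AddAction ℤ X where
  vadd n x := ⟨shiftZ n x, by
    induction n using Int.induction_on with
    | zero =>
      have : shiftZ 0 (x : ℤ → Λ) = x := funext fun m => congrArg x.1 (add_zero m)
      rw [this]; exact x.2
    | succ i ih =>
      have : shiftZ ((i : ℤ) + 1) (x : ℤ → Λ) = shiftMap (shiftZ i x) :=
        funext fun m => congrArg x.1 (show m + (i + 1) = m + 1 + i by ring)
      rw [this]; exact (hXinv _).1 ih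
    | pred i ih =>
      have : shiftMap (shiftZ (-(i : ℤ) - 1) (x : ℤ → Λ)) = shiftZ (-(i : ℤ)) x :=
        funext fun m => congrArg x.1 (show m + 1 + (-i - 1) = m + -i by ring)
      rw [hXinv, this]; exact ih⟩
  zero_vadd x := Subtype.ext <| funext fun m => congrArg x.1 (add_zero m)
  add_vadd m n x := Subtype.ext <| funext fun i => congrArg x.1 (add_assoc i m n).symm

theorem continuous_shiftZ {Λ : Type*} [TopologicalSpace Λ] (n : ℤ) :
    Continuous (shiftZ n : (ℤ → Λ) → ℤ → Λ) :=
  continuous_pi fun m => continuous_apply (m + n)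

/-- An aperiodic subshift of entropy less than `log₂ ℓ` maps continuously, equivariantly and
injectively to the full shift on `ℓ` symbols. -/
theorem exists_injective_equivariant {Λ : Type} [Fintype Λ] [TopologicalSpace Λ]
    [DiscreteTopology Λ] {X : Set (ℤ → Λ)} (hX : X.Nonempty) (hXcl : IsClosed X)
    (hXinv : ∀ x, x ∈ X ↔ shiftMap x ∈ X)
    (haper : ∀ x ∈ X, ∀ n : ℕ, 1 ≤ n → shiftZ (n : ℤ) x ≠ x) {h : ℝ}
    (hent : Tendsto (fun n : ℕ => Real.logb 2 (Nat.card (wordsOf X n)) / (n : ℝ)) atTop (𝓝 h))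
    {ℓ : ℕ} (hℓ : (2 : ℝ) ^ h < ℓ) :
    ∃ f : X → ℤ → Fin ℓ, Continuous f ∧ Function.Injective f ∧
      ∀ x : X, f ⟨shiftMap x, (hXinv x).1 x.2⟩ = shiftMap (f x) := by
  classical
  let := subshiftAddAction X hXinv
  have hvadd : ∀ (n m : ℤ) (x : X), (n +ᵥ x : X).1 m = x.1 (m + n) := fun _ _ _ => rfl
  have : ContinuousConstVAdd ℤ X :=
    ⟨fun n => ((continuous_shiftZ n).comp continuous_subtype_val).subtype_mk _⟩
  have : CompactSpace X := isCompact_iff_compactSpace.1 hXcl.isCompact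
  have hfree : ∀ (x : X) (n : ℤ), 0 < n → n +ᵥ x ≠ x := by
    intro x n hn hx
    lift n to ℕ using hn.le
    exact haper x x.2 n (by exact_mod_cast hn) (congrArg Subtype.val hx)
  have hℓ2 : 1 < ℓ := by
    have hh0 : 0 ≤ h := ge_of_tendsto' hent fun n => by
      have := (wordsOf_nonempty hX n).to_subtype
      exact div_nonneg (Real.logb_nonneg one_lt_two (by exact_mod_cast Nat.card_pos))
        n.cast_nonneg
    exact_mod_cast (Real.one_le_rpow one_le_two hh0).trans_lt hℓ
  obtain ⟨a, b, hab⟩ : ∃ a b : Fin ℓ, a ≠ b := ⟨⟨0, by omega⟩, ⟨1, hℓ2⟩, by simp⟩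
  obtain ⟨k, N, hk, hkN, e, he⟩ := exists_word_encoding hX hent hℓ
  obtain ⟨F, hF, hdisj, hcov⟩ := exists_isClopen_marker hfree (N := N) (by omega)
  have hr : ∀ x : X, ∃ r : ℕ, (-(r : ℤ)) +ᵥ x ∈ F := by
    intro x
    obtain ⟨i, hi, hiF⟩ := hcov ((-N : ℤ) +ᵥ x)
    rw [Finset.mem_Ioo] at hi
    refine ⟨(N - i).toNat, ?_⟩
    rw [vadd_vadd] at hiF
    convert hiF using 2
    omega
  have hs : ∀ x : X, ∃ s : ℕ, ((s : ℤ) + 1) +ᵥ x ∈ F := by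
    intro x
    obtain ⟨i, hi, hiF⟩ := hcov ((N : ℤ) +ᵥ x)
    rw [Finset.mem_Ioo] at hi
    refine ⟨(N + i - 1).toNat, ?_⟩
    rw [vadd_vadd] at hiF
    convert hiF using 2
    omega
  have hrs : ∀ x : X, ∀ i : ℤ, ∃ (p : ℤ) (n j : ℕ), IsReturnBlock F x p n ∧ j < n ∧
      i = p + j := fun x i =>
    ⟨_, _, Nat.find (hr (i +ᵥ x)), isReturnBlock_of_find i (hr _) (hs _), by omega, by omega⟩
  have hopen : ∀ i : ℤ, ∀ x : X, ∀ᶠ z in 𝓝 x, (i +ᵥ z ∈ F ↔ i +ᵥ x ∈ F) := by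
    intro i x
    have hc : IsClopen ((i +ᵥ ·) ⁻¹' F : Set X) := hF.preimage (continuous_const_vadd i)
    by_cases hx : i +ᵥ x ∈ F
    · filter_upwards [hc.isOpen.mem_nhds hx] with z hz using iff_of_true hz hx
    · filter_upwards [hc.compl.isOpen.mem_nhds hx] with z hz using iff_of_false hz hx
  let g : ℕ → ℕ → X → Fin ℓ := fun r s z =>
    blockCode a b k (e (r + s + 1) fun t => z.1 ((t : ℤ) - r)) r
  let f₀ : X → Fin ℓ := fun z => g (Nat.find (hr z)) (Nat.find (hs z)) z
  have hg : ∀ r s, Continuous (g r s) := by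
    intro r s
    have h1 : Continuous fun z : X => fun t : Fin (r + s + 1) => z.1 ((t : ℤ) - r) :=
      continuous_pi fun t => (continuous_apply _).comp continuous_subtype_val
    exact (continuous_of_discreteTopology
      (f := fun w : Fin (r + s + 1) → Λ => blockCode a b k (e (r + s + 1) w) r)).comp h1
  have hf₀ : Continuous f₀ := by
    refine continuous_iff_continuousAt.2 fun x => ?_
    refine (hg (Nat.find (hr x)) (Nat.find (hs x))).continuousAt.congr ?_
    have h1 : ∀ᶠ z in 𝓝 x, ∀ m ∈ Finset.range (Nat.find (hr x) + 1),
        ((-(m : ℤ)) +ᵥ z ∈ F ↔ (-(m : ℤ)) +ᵥ x ∈ F) :=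
      (Filter.eventually_all_finset _).2 fun m _ => hopen _ x
    have h2 : ∀ᶠ z in 𝓝 x, ∀ m ∈ Finset.range (Nat.find (hs x) + 1),
        (((m : ℤ) + 1) +ᵥ z ∈ F ↔ ((m : ℤ) + 1) +ᵥ x ∈ F) :=
      (Filter.eventually_all_finset _).2 fun m _ => hopen _ x
    filter_upwards [h1, h2] with z hz1 hz2
    have e1 : Nat.find (hr z) = Nat.find (hr x) := (Nat.find_eq_iff _).2
      ⟨(hz1 _ (by simp)).2 (Nat.find_spec (hr x)), fun m hm hmem =>
        Nat.find_min (hr x) hm ((hz1 m (Finset.mem_range.2 (by omega))).1 hmem)⟩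
    have e2 : Nat.find (hs z) = Nat.find (hs x) := (Nat.find_eq_iff _).2
      ⟨(hz2 _ (by simp)).2 (Nat.find_spec (hs x)), fun m hm hmem =>
        Nat.find_min (hs x) hm ((hz2 m (Finset.mem_range.2 (by omega))).1 hmem)⟩
    simp only [f₀, e1, e2]
  have hcode : ∀ (x : X) (p : ℤ) (n : ℕ), IsReturnBlock F x p n → ∀ j : ℕ, j < n →
      f₀ ((p + (j : ℤ)) +ᵥ x) = blockCode a b k (e n fun t => x.1 (p + t)) j := by
    intro x p n hb j hj
    obtain ⟨e1, e2⟩ := hb.find_eq hj (hr _) (hs _)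
    obtain ⟨s, rfl⟩ : ∃ s, n = j + s + 1 := ⟨n - 1 - j, by omega⟩
    rw [show j + s + 1 - 1 - j = s by omega] at e2
    change g (Nat.find (hr _)) (Nat.find (hs _)) _ = _
    rw [e1, e2]
    simp only [g, hvadd]
    congr 2
    funext t
    ring_nf
  refine ⟨fun x i => f₀ (i +ᵥ x),
    continuous_pi fun i => hf₀.comp (continuous_const_vadd i), ?_, ?_⟩
  · intro x x' hxx'
    have hxx' : ∀ i : ℤ, f₀ (i +ᵥ x) = f₀ (i +ᵥ x') := congrFun hxx'
    have hvisit : ∀ i : ℤ, i +ᵥ x ∈ F ↔ i +ᵥ x' ∈ F := by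
      intro i
      rw [vadd_mem_iff_of_blockCode hab hk hkN hdisj (hrs x) (y := fun i => f₀ (i +ᵥ x))
          (fun p n hb => ⟨_, hcode x p n hb⟩),
        vadd_mem_iff_of_blockCode hab hk hkN hdisj (hrs x') (y := fun i => f₀ (i +ᵥ x'))
          (fun p n hb => ⟨_, hcode x' p n hb⟩)]
      simp only [hxx']
    refine Subtype.ext (funext fun i => ?_)
    obtain ⟨p, n, j, hb, hj, rfl⟩ := hrs x i
    have hword : (fun t : Fin n => x.1 (p + t)) = fun t : Fin n => x'.1 (p + t) := by
      refine he n (hb.le_length hdisj) _ ⟨x, x.2, p, fun _ => rfl⟩ _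
        ⟨x', x'.2, p, fun _ => rfl⟩ fun m hm => ?_
      simp only [freePositions, Finset.mem_filter, Finset.mem_range] at hm
      have hm' := hxx' (p + m)
      rw [hcode x p n hb m hm.1, hcode x' p n (hb.congr hvisit) m hm.1] at hm'
      simpa only [blockCode, if_neg (show m ≠ 0 by omega), if_neg (not_lt.2 hm.2.1),
        if_neg hm.2.2] using hm'
    exact congrFun hword ⟨j, hj⟩
  · intro x
    funext i
    have h1 : (⟨shiftMap x, (hXinv x).1 x.2⟩ : X) = (1 : ℤ) +ᵥ x := rfl
    simp only [h1, shiftMap, vadd_vadd]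

theorem stmt_10 {Λ : Type} [Fintype Λ] [TopologicalSpace Λ] [DiscreteTopology Λ]
    (X : Set (ℤ → Λ))
    (hX : X.Nonempty) (hXcl : IsClosed X) (hXinv : ∀ x, x ∈ X ↔ shiftMap x ∈ X)
    (haper : ∀ x ∈ X, ∀ n : ℕ, 1 ≤ n → shiftZ (n : ℤ) x ≠ x)
    (h : ℝ)
    (hent : Tendsto (fun n : ℕ => Real.logb 2 (Nat.card (wordsOf X n)) / (n : ℝ))
      atTop (nhds h))
    (ℓ : ℕ) (hℓ1 : (2 : ℝ) ^ h < ℓ) (hℓ2 : ∀ m : ℕ, (2 : ℝ) ^ h < m → ℓ ≤ m) :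
    ∃ (A : Type) (_ : Fintype A) (_ : TopologicalSpace A) (_ : DiscreteTopology A),
      Nat.card A = ℓ ∧
      ∃ Y : Set (ℤ → A),
        Y.Nonempty ∧ IsClosed Y ∧ (∀ y, y ∈ Y ↔ shiftMap y ∈ Y) ∧
        ∃ φ : ↥X ≃ₜ ↥Y, ∀ x : ↥X,
          (↑(φ ⟨shiftMap (↑x : ℤ → Λ), (hXinv ↑x).mp x.2⟩) : ℤ → A) =
            shiftMap (↑(φ x) : ℤ → A) := by
  obtain ⟨f, hf, hinj, hequiv⟩ := exists_injective_equivariant hX hXcl hXinv haper hent hℓ1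
  have : CompactSpace X := isCompact_iff_compactSpace.1 hXcl.isCompact
  have hemb := hf.isClosedEmbedding hinj
  refine ⟨Fin ℓ, inferInstance, inferInstance, inferInstance, by simp, Set.range f,
    ?_, hemb.isClosed_range, fun y => ⟨?_, ?_⟩, hemb.isEmbedding.toHomeomorph, fun x => ?_⟩
  · obtain ⟨x, hx⟩ := hX
    exact ⟨_, ⟨x, hx⟩, rfl⟩
  · rintro ⟨x, rfl⟩
    exact ⟨_, hequiv x⟩
  · rintro ⟨x, hx⟩
    have hx' : shiftMap (shiftZ (-1) x.1) = x.1 := by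
      funext m
      simp [shiftMap, shiftZ]
    refine ⟨⟨shiftZ (-1) x.1, (hXinv _).2 (by rw [hx']; exact x.2)⟩, ?_⟩
    have h1 := hequiv ⟨shiftZ (-1) x.1, (hXinv _).2 (by rw [hx']; exact x.2)⟩
    simp only [hx', Subtype.coe_eta, hx] at h1
    funext m
    simpa [shiftMap] using (congrFun h1 (m - 1)).symm
  · exact hequiv x
end
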